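/- There is exactly one continuously differentiable function h on ℝ satisfying h'(s) + (n-2)·h(s) + β0·e^{-(ρ1/β0)s}·q̃(s)·h(s) = α0(n-2)/β0 for all s ∈ ℝ, where q̃(s) = η·exp(∫_{-∞}^{s} h(ρ) dρ), and such that 0 < h(s)·e^{-(ρ1/β0)s} ≤ C0/η for all s ∈ ℝ. -/

import Mathlib

open Real Set Filter MeasureTheory

/-- `h` is a solution on `ℝ` of the ODE
`h' + (n-2) h + β0 e^{-(ρ1/β0)s} q̃ h = α0(n-2)/β0` where
`q̃(s) = η exp(∫_{-∞}^s h)`, satisfying `0 < h(s) e^{-(ρ1/β0)s} ≤ C0/η`. -/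
def HODEReal (n : ℕ) (ρ1 η β0 α0 C0 : ℝ) (h : ℝ → ℝ) : Prop :=
  ContDiff ℝ 1 h ∧
  (∀ s : ℝ, MeasureTheory.IntegrableOn h (Set.Iio s)) ∧
  (∀ s : ℝ,
    deriv h s + ((n : ℝ) - 2) * h s
      + β0 * Real.exp (-(ρ1 / β0) * s) *
          (η * Real.exp (∫ ρ in Set.Iio s, h ρ)) * h s
      = α0 * ((n : ℝ) - 2) / β0) ∧
  (∀ s : ℝ, 0 < h s * Real.exp (-(ρ1 / β0) * s) ∧
    h s * Real.exp (-(ρ1 / β0) * s) ≤ C0 / η)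

/-- A differentiable function with nonnegative derivative vanishing at `-∞` is nonnegative. -/
lemma nonneg_of_hasDerivAt_of_tendsto_atBot {f f' : ℝ → ℝ} (hf : ∀ s, HasDerivAt f (f' s) s)
    (hf' : ∀ s, 0 ≤ f' s) (h0 : Tendsto f atBot (nhds 0)) (s : ℝ) : 0 ≤ f s :=
  (monotone_of_deriv_nonneg (fun s => (hf s).differentiableAt)
    (fun s => (hf s).deriv ▸ hf' s)).le_of_tendsto h0 s

lemma Continuous.integrableOn_Iic_of_integrableOn_Iic {f : ℝ → ℝ} (hf : Continuous f) {a : ℝ}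
    (hi : IntegrableOn f (Iic a)) (s : ℝ) : IntegrableOn f (Iic s) := by
  refine (hi.union (hf.integrableOn_Icc (a := a) (b := s))).mono_set fun x hx => ?_
  rcases le_total x a with h | h
  exacts [Or.inl h, Or.inr ⟨h, hx⟩]

lemma integral_Iio_eq_add_intervalIntegral {f : ℝ → ℝ} (hf : Continuous f)
    (hi : IntegrableOn f (Iic 0)) (s : ℝ) :
    ∫ t in Iio s, f t = (∫ t in Iic 0, f t) + ∫ t in (0 : ℝ)..s, f t := by
  have := intervalIntegral.integral_Iic_sub_Iic hi (hf.integrableOn_Iic_of_integrableOn_Iic hi s)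
  rw [← integral_Iic_eq_integral_Iio]
  linarith

lemma hasDerivAt_integral_Iio {f : ℝ → ℝ} (hf : Continuous f)
    (hi : IntegrableOn f (Iic 0)) (s : ℝ) :
    HasDerivAt (fun s => ∫ t in Iio s, f t) (f s) s := by
  rw [funext (integral_Iio_eq_add_intervalIntegral hf hi)]
  exact (hf.integral_hasStrictDerivAt 0 s).hasDerivAt.const_add _

lemma tendsto_integral_Iio_atBot {f : ℝ → ℝ} (hf : Continuous f)
    (hi : IntegrableOn f (Iic 0)) :
    Tendsto (fun s => ∫ t in Iio s, f t) atBot (nhds 0) := by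
  rw [funext (integral_Iio_eq_add_intervalIntegral hf hi)]
  have := (intervalIntegral_tendsto_integral_Iic (0 : ℝ) hi tendsto_id).const_sub
    (∫ t in Iic 0, f t)
  rw [sub_self] at this
  refine this.congr fun s => ?_
  rw [intervalIntegral.integral_symm]
  simp [sub_eq_add_neg]

lemma tendsto_exp_const_mul_atBot {c : ℝ} (hc : 0 < c) :
    Tendsto (fun s => rexp (c * s)) atBot (nhds 0) :=
  Real.tendsto_exp_atBot.comp (tendsto_id.const_mul_atBot hc)

lemma hasDerivAt_exp_const_mul (c s : ℝ) :
    HasDerivAt (fun s => rexp (c * s)) (c * rexp (c * s)) s := by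
  have := ((hasDerivAt_id s).const_mul c).exp
  simpa [mul_comm] using this

/-- Comparison principle on the line for `y' + a y ≥ 0` with `a ≥ 0` and `y` vanishing
at `-∞`. -/
lemma nonneg_of_linear_differential_inequality {a y y' : ℝ → ℝ} (ha : Continuous a)
    (ha0 : ∀ s, 0 ≤ a s) (hy : ∀ s, HasDerivAt y (y' s) s) (hineq : ∀ s, 0 ≤ y' s + a s * y s)
    (h0 : Tendsto y atBot (nhds 0)) (s : ℝ) : 0 ≤ y s := by
  set P : ℝ → ℝ := fun s => ∫ t in (0 : ℝ)..s, a t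
  have hP : ∀ s, HasDerivAt P (a s) s := fun s => (ha.integral_hasStrictDerivAt 0 s).hasDerivAt
  have hPm : Monotone P := monotone_of_deriv_nonneg (fun s => (hP s).differentiableAt)
    (fun s => (hP s).deriv ▸ ha0 s)
  have hd : ∀ s, HasDerivAt (fun s => y s * rexp (P s))
      ((y' s + a s * y s) * rexp (P s)) s := fun s => by
    convert! (hy s).mul (hP s).exp using 1
    ring
  have ht : Tendsto (fun s => y s * rexp (P s)) atBot (nhds 0) := by
    refine squeeze_zero_norm' (a := fun s => |y s| * rexp (P 0)) ?_ ?_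
    · filter_upwards [eventually_le_atBot (0 : ℝ)] with s hs
      rw [norm_mul, Real.norm_eq_abs, Real.norm_of_nonneg (Real.exp_pos _).le]
      gcongr
      exact hPm hs
    · simpa using h0.abs.mul_const (rexp (P 0))
  exact nonneg_of_mul_nonneg_left (nonneg_of_hasDerivAt_of_tendsto_atBot hd
    (fun s => mul_nonneg (hineq s) (Real.exp_pos _).le) ht s) (Real.exp_pos _)

/-- Continuous functions trapped between `0` and `D e^{cs}`. -/
def ExpTrapped (c D : ℝ) (h : ℝ → ℝ) : Prop :=
  Continuous h ∧ ∀ s, 0 ≤ h s ∧ h s ≤ D * rexp (c * s)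

/-- The coefficient `k + B e^{-cs} exp (∫_{-∞}^s h)`. -/
noncomputable def dampingCoeff (k B c : ℝ) (h : ℝ → ℝ) (s : ℝ) : ℝ :=
  k + B * rexp (-c * s) * rexp (∫ t in Iio s, h t)

namespace ExpTrapped

variable {c D : ℝ} {h : ℝ → ℝ}

lemma integrableOn_Iic (hc : 0 < c) (hh : ExpTrapped c D h) (s : ℝ) :
    IntegrableOn h (Iic s) := by
  refine Integrable.mono' ((integrableOn_exp_mul_Iic hc s).const_mul D)
    hh.1.aestronglyMeasurable (Eventually.of_forall fun t => ?_)
  rw [Real.norm_of_nonneg (hh.2 t).1]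
  exact (hh.2 t).2

lemma tendsto_atBot (hc : 0 < c) (hh : ExpTrapped c D h) : Tendsto h atBot (nhds 0) :=
  squeeze_zero (fun s => (hh.2 s).1) (fun s => (hh.2 s).2)
    (by simpa using (tendsto_exp_const_mul_atBot hc).const_mul D)

lemma integral_Iio_nonneg (hh : ExpTrapped c D h) (s : ℝ) : 0 ≤ ∫ t in Iio s, h t :=
  integral_nonneg fun t => (hh.2 t).1

lemma integral_Iio_le (hc : 0 < c) (hh : ExpTrapped c D h) (s : ℝ) :
    ∫ t in Iio s, h t ≤ D / c * rexp (c * s) := by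
  have hi := hh.integrableOn_Iic hc 0
  rw [← sub_nonneg]
  refine nonneg_of_hasDerivAt_of_tendsto_atBot
    (f := fun s => D / c * rexp (c * s) - ∫ t in Iio s, h t)
    (fun s => ((hasDerivAt_exp_const_mul c s).const_mul (D / c)).sub
      (hasDerivAt_integral_Iio hh.1 hi s)) (fun s => ?_) ?_ s
  · have := (hh.2 s).2
    rw [← mul_assoc, div_mul_cancel₀ _ hc.ne']
    linarith
  · simpa using ((tendsto_exp_const_mul_atBot hc).const_mul (D / c)).sub
      (tendsto_integral_Iio_atBot hh.1 hi)

lemma continuous_dampingCoeff (hc : 0 < c) (hh : ExpTrapped c D h) (k B : ℝ) :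
    Continuous (dampingCoeff k B c h) := by
  have : Continuous fun s => ∫ t in Iio s, h t := continuous_iff_continuousAt.2 fun s =>
    (hasDerivAt_integral_Iio hh.1 (hh.integrableOn_Iic hc 0) s).continuousAt
  unfold dampingCoeff
  fun_prop

lemma le_dampingCoeff (hh : ExpTrapped c D h) (k : ℝ) {B : ℝ} (hB : 0 ≤ B) (s : ℝ) :
    k + B * rexp (-c * s) ≤ dampingCoeff k B c h s := by
  have := Real.one_le_exp (hh.integral_Iio_nonneg s)
  have h2 : 0 ≤ B * rexp (-c * s) := by positivity
  unfold dampingCoeff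
  nlinarith

/-- The linear equation `y' + a y = BD`, with `a` the coefficient attached to a trapped `h`,
has a positive trapped solution. -/
lemma exists_linear_solution (hc : 0 < c) (hD : 0 < D) (hh : ExpTrapped c D h) {k B : ℝ}
    (hk : 0 < k) (hB : 0 < B) :
    ∃ y, ExpTrapped c D y ∧ (∀ s, 0 < y s) ∧
      ∀ s, HasDerivAt y (B * D - dampingCoeff k B c h s * y s) s := by
  set a := dampingCoeff k B c h
  have ha : Continuous a := hh.continuous_dampingCoeff hc k B
  have hle : ∀ s, k + B * rexp (-c * s) ≤ a s := hh.le_dampingCoeff k hB.le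
  have hka : ∀ s, k ≤ a s := fun s => by
    have := hle s
    have : 0 < B * rexp (-c * s) := by positivity
    linarith
  set P : ℝ → ℝ := fun s => ∫ t in (0 : ℝ)..s, a t with hPdef
  have hP : ∀ s, HasDerivAt P (a s) s := fun s => (ha.integral_hasStrictDerivAt 0 s).hasDerivAt
  have hPc : Continuous P := continuous_iff_continuousAt.2 fun s => (hP s).continuousAt
  have hPle : ∀ s ≤ 0, P s ≤ k * s := by
    intro s hs
    have hm : Monotone fun s => P s - k * s := by
      have hd : ∀ s, HasDerivAt (fun s => P s - k * s) (a s - k) s := fun s => by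
        convert! (hP s).sub ((hasDerivAt_id s).const_mul k) using 1
        ring
      exact monotone_of_deriv_nonneg (fun s => (hd s).differentiableAt)
        (fun s => by rw [(hd s).deriv]; linarith [hka s])
    have := hm hs
    simp only [hPdef, intervalIntegral.integral_same] at this ⊢
    linarith
  have hPe : ∀ s ≤ 0, rexp (P s) ≤ rexp (k * s) := fun s hs => Real.exp_le_exp.2 (hPle s hs)
  have hPt : Tendsto (fun s => rexp (P s)) atBot (nhds 0) := by
    refine squeeze_zero' (Eventually.of_forall fun s => (Real.exp_pos _).le) ?_
      (tendsto_exp_const_mul_atBot hk)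
    filter_upwards [eventually_le_atBot (0 : ℝ)] with s hs using hPe s hs
  have hec : Continuous fun s => B * D * rexp (P s) := by fun_prop
  have hei : IntegrableOn (fun s => B * D * rexp (P s)) (Iic 0) := by
    refine Integrable.const_mul ?_ _
    refine Integrable.mono' (integrableOn_exp_mul_Iic hk 0)
      (Real.continuous_exp.comp hPc).aestronglyMeasurable
      ((ae_restrict_iff' measurableSet_Iic).2 (Eventually.of_forall fun t ht => ?_))
    rw [Real.norm_of_nonneg (Real.exp_pos _).le]
    exact hPe t ht
  set F : ℝ → ℝ := fun s => ∫ t in Iio s, B * D * rexp (P t)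
  have hF : ∀ s, HasDerivAt F (B * D * rexp (P s)) s := hasDerivAt_integral_Iio hec hei
  have hFt : Tendsto F atBot (nhds 0) := tendsto_integral_Iio_atBot hec hei
  have hF0 : ∀ s, 0 < F s := fun s => lt_of_le_of_lt
    (nonneg_of_hasDerivAt_of_tendsto_atBot hF (fun s => by positivity) hFt (s - 1))
    (strictMono_of_hasDerivAt_pos hF (fun s => by positivity) (by linarith))
  have hFle : ∀ s, F s ≤ D * rexp (c * s) * rexp (P s) := by
    intro s
    rw [← sub_nonneg]
    refine nonneg_of_hasDerivAt_of_tendsto_atBot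
      (f := fun s => D * rexp (c * s) * rexp (P s) - F s)
      (fun s => (((hasDerivAt_exp_const_mul c s).const_mul D).mul (hP s).exp).sub (hF s))
      (fun s => ?_) ?_ s
    · have h1 : rexp (-c * s) * rexp (c * s) = 1 := by rw [← Real.exp_add]; simp
      have h2 : B * D ≤ a s * (D * rexp (c * s)) := by
        calc B * D = B * rexp (-c * s) * (D * rexp (c * s)) := by
              linear_combination (-B * D) * h1
          _ ≤ a s * (D * rexp (c * s)) := by
              gcongr
              linarith [hle s]
      have h3 : 0 < rexp (P s) := Real.exp_pos _
      have h4 : 0 < D * (c * rexp (c * s)) * rexp (P s) := by positivity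
      nlinarith
    · simpa using (((tendsto_exp_const_mul_atBot hc).const_mul D).mul hPt).sub hFt
  have hy : ∀ s, HasDerivAt (fun s => F s * rexp (-P s))
      (B * D - a s * (F s * rexp (-P s))) s := fun s => by
    convert! (hF s).mul (hP s).neg.exp using 1
    have h1 : rexp (P s) * rexp (-P s) = 1 := by rw [← Real.exp_add]; simp
    linear_combination (-B * D) * h1
  refine ⟨fun s => F s * rexp (-P s), ⟨continuous_iff_continuousAt.2 fun s =>
    (hy s).continuousAt, fun s => ⟨by have := hF0 s; positivity, ?_⟩⟩,
    fun s => by have := hF0 s; positivity, hy⟩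
  simp only [Real.exp_neg, ← div_eq_mul_inv]
  exact (div_le_iff₀ (Real.exp_pos _)).2 (hFle s)

end ExpTrapped

/-- The weight against which the solution operator is a contraction. -/
noncomputable def contractionWeight (c D L s : ℝ) : ℝ :=
  rexp (c * s + L / D * rexp (D / c * rexp (c * s)))

lemma hasDerivAt_contractionWeight {c D : ℝ} (hc : 0 < c) (hD : 0 < D) (L s : ℝ) :
    HasDerivAt (contractionWeight c D L)
      ((c + L * rexp (c * s) * rexp (D / c * rexp (c * s))) * contractionWeight c D L s) s := by
  have h1 := (((hasDerivAt_exp_const_mul c s).const_mul (D / c)).exp).const_mul (L / D)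
  have h2 := (((hasDerivAt_id s).const_mul c).add h1).exp
  convert! h2 using 1
  simp only [contractionWeight, Pi.add_apply, id]
  field_simp

lemma tendsto_contractionWeight_atBot {c : ℝ} (hc : 0 < c) (D L : ℝ) :
    Tendsto (contractionWeight c D L) atBot (nhds 0) := by
  have h0 := tendsto_exp_const_mul_atBot hc
  have h1 := ((Real.continuous_exp.tendsto _).comp (h0.const_mul (D / c))).const_mul (L / D)
  have h2 := h0.mul ((Real.continuous_exp.tendsto _).comp h1)
  rw [zero_mul] at h2
  refine h2.congr fun s => ?_
  simp [contractionWeight, Real.exp_add]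

/-- A constant for which `contractionWeight` grows fast enough. -/
noncomputable def contractionRate (c B D : ℝ) : ℝ :=
  2 * (B * D) / c + (2 * (B * D) / c * rexp (D / c)) ^ 2 / B

lemma contractionRate_spec {c B D : ℝ} (hc : 0 < c) (hB : 0 < B) (hD : 0 < D) (s : ℝ) :
    2 * (B * D) / c * rexp (D / c * rexp (c * s)) ≤
      contractionRate c B D * rexp (c * s) * rexp (D / c * rexp (c * s)) +
        B * rexp (-c * s) := by
  unfold contractionRate
  set K := 2 * (B * D) / c
  have hK0 : 0 < K := by positivity
  set κ := D / c
  have hκ : 0 < κ := by positivity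
  have hx : 0 < rexp (c * s) := Real.exp_pos _
  rw [neg_mul, Real.exp_neg]
  set x := rexp (c * s)
  have hE1 : 1 ≤ rexp (κ * x) := Real.one_le_exp (by positivity)
  rcases le_total 1 x with h | h
  · have h1 : K ≤ (K + (K * rexp κ) ^ 2 / B) * x := by
      have : 0 ≤ (K * rexp κ) ^ 2 / B := by positivity
      nlinarith
    have h2 : 0 ≤ B * x⁻¹ := by positivity
    nlinarith [Real.exp_pos (κ * x)]
  · set J := K * rexp κ with hJ
    have h1 : K * rexp (κ * x) ≤ J := by
      rw [hJ]
      gcongr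
      nlinarith
    have h2 : J ≤ J ^ 2 / B * x + B * x⁻¹ := by
      have : J ^ 2 / B * x + B * x⁻¹ - J = ((J * x - B / 2) ^ 2 + 3 / 4 * B ^ 2) / (B * x) := by
        field_simp
        ring
      have : 0 ≤ ((J * x - B / 2) ^ 2 + 3 / 4 * B ^ 2) / (B * x) := by positivity
      linarith
    have h3 : J ^ 2 / B * x ≤ (K + J ^ 2 / B) * x * rexp (κ * x) := by
      have : 0 ≤ J ^ 2 / B * x := by positivity
      have : 0 ≤ K * x := by positivity
      nlinarith
    linarith

lemma abs_exp_sub_exp_le {x y M : ℝ} (hx : x ≤ M) (hy : y ≤ M) :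
    |rexp x - rexp y| ≤ rexp M * |x - y| := by
  wlog hxy : y ≤ x generalizing x y
  · rw [abs_sub_comm, abs_sub_comm x]
    exact this hy hx (le_of_not_ge hxy)
  rw [abs_of_nonneg (sub_nonneg.2 (Real.exp_le_exp.2 hxy)), abs_of_nonneg (sub_nonneg.2 hxy)]
  have h1 : rexp x * (1 - (x - y)) ≤ rexp y := by
    calc rexp x * (1 - (x - y)) ≤ rexp x * rexp (-(x - y)) := by
          gcongr
          exact Real.one_sub_le_exp_neg _
      _ = rexp y := by rw [← Real.exp_add]; ring_nf
  have h2 : rexp x ≤ rexp M := Real.exp_le_exp.2 hx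
  nlinarith

section Contraction

variable {k c B D M : ℝ} {h₁ h₂ y₁ y₂ : ℝ → ℝ}

lemma integral_Iio_sub_le_weight (hc : 0 < c) (hB : 0 < B) (hD : 0 < D)
    (hh₁ : ExpTrapped c D h₁) (hh₂ : ExpTrapped c D h₂)
    (hM : ∀ s, |h₁ s - h₂ s| ≤ M * contractionWeight c D (contractionRate c B D) s) (s : ℝ) :
    (∫ t in Iio s, h₁ t) - ∫ t in Iio s, h₂ t ≤
      M / c * contractionWeight c D (contractionRate c B D) s := by
  have hi₁ := hh₁.integrableOn_Iic hc 0
  have hi₂ := hh₂.integrableOn_Iic hc 0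
  set L := contractionRate c B D
  have hL : 0 < L := by simp only [L, contractionRate]; positivity
  rw [← sub_nonneg]
  refine nonneg_of_hasDerivAt_of_tendsto_atBot
    (f := fun s => M / c * contractionWeight c D L s -
      ((∫ t in Iio s, h₁ t) - ∫ t in Iio s, h₂ t))
    (fun s => ((hasDerivAt_contractionWeight hc hD L s).const_mul (M / c)).sub
      ((hasDerivAt_integral_Iio hh₁.1 hi₁ s).sub (hasDerivAt_integral_Iio hh₂.1 hi₂ s)))
    (fun s => ?_) ?_ s
  · have h1 := hM s
    have h2 := le_abs_self (h₁ s - h₂ s)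
    have h3 : 0 ≤ M * contractionWeight c D L s := (abs_nonneg _).trans h1
    have h4 : M / c * ((c + L * rexp (c * s) * rexp (D / c * rexp (c * s))) *
        contractionWeight c D L s) = M * contractionWeight c D L s +
        L * rexp (c * s) * rexp (D / c * rexp (c * s)) / c *
          (M * contractionWeight c D L s) := by
      field_simp
    rw [h4]
    have : 0 ≤ L * rexp (c * s) * rexp (D / c * rexp (c * s)) / c *
          (M * contractionWeight c D L s) := mul_nonneg (by positivity) h3
    linarith
  · simpa using ((tendsto_contractionWeight_atBot hc D L).const_mul (M / c)).sub
      ((tendsto_integral_Iio_atBot hh₁.1 hi₁).sub (tendsto_integral_Iio_atBot hh₂.1 hi₂))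

lemma linear_solution_sub_le (hk : 0 < k) (hc : 0 < c) (hB : 0 < B) (hD : 0 < D)
    (hh₁ : ExpTrapped c D h₁) (hh₂ : ExpTrapped c D h₂)
    (hy₁ : ExpTrapped c D y₁) (hy₂ : ExpTrapped c D y₂)
    (hd₁ : ∀ s, HasDerivAt y₁ (B * D - dampingCoeff k B c h₁ s * y₁ s) s)
    (hd₂ : ∀ s, HasDerivAt y₂ (B * D - dampingCoeff k B c h₂ s * y₂ s) s)
    (hM : ∀ s, |h₁ s - h₂ s| ≤ M * contractionWeight c D (contractionRate c B D) s) (s : ℝ) :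
    y₁ s - y₂ s ≤ M / 2 * contractionWeight c D (contractionRate c B D) s := by
  have hle := hh₁.le_dampingCoeff k hB.le
  have hint := integral_Iio_sub_le_weight hc hB hD hh₁ hh₂ hM
  have hint' := integral_Iio_sub_le_weight hc hB hD hh₂ hh₁
    (fun s => by rw [abs_sub_comm]; exact hM s)
  have hspec := contractionRate_spec hc hB hD
  set L := contractionRate c B D
  set w := contractionWeight c D L
  rw [← sub_nonneg]
  refine nonneg_of_linear_differential_inequality (a := dampingCoeff k B c h₁)
    (y := fun s => M / 2 * w s - (y₁ s - y₂ s))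
    (hh₁.continuous_dampingCoeff hc k B)
    (fun s => le_trans (by positivity) (hle s))
    (fun s => ((hasDerivAt_contractionWeight hc hD L s).const_mul (M / 2)).sub
      ((hd₁ s).sub (hd₂ s))) (fun s => ?_) ?_ s
  · have hMw : 0 ≤ M * w s := (abs_nonneg _).trans (hM s)
    have hH : |(∫ t in Iio s, h₁ t) - ∫ t in Iio s, h₂ t| ≤ M / c * w s :=
      abs_le.2 ⟨by linarith [hint' s], hint s⟩
    have hE := abs_exp_sub_exp_le (hh₁.integral_Iio_le hc s) (hh₂.integral_Iio_le hc s)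
    set E := rexp (D / c * rexp (c * s))
    have hE0 : 0 < E := Real.exp_pos _
    have h1 : rexp (-c * s) * rexp (c * s) = 1 := by rw [← Real.exp_add]; simp
    have hdiff : |(dampingCoeff k B c h₂ s - dampingCoeff k B c h₁ s) * y₂ s| ≤
        B * D / c * E * (M * w s) := by
      have h2 : dampingCoeff k B c h₂ s - dampingCoeff k B c h₁ s = B * rexp (-c * s) *
          -(rexp (∫ t in Iio s, h₁ t) - rexp (∫ t in Iio s, h₂ t)) := by
        unfold dampingCoeff
        ring
      rw [h2, abs_mul, abs_mul, abs_neg, abs_of_nonneg (hy₂.2 s).1,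
        abs_of_pos (show 0 < B * rexp (-c * s) by positivity)]
      calc _ ≤ B * rexp (-c * s) * (E * (M / c * w s)) * (D * rexp (c * s)) := by
            have hMcw : 0 ≤ M / c * w s := (abs_nonneg _).trans hH
            gcongr
            · exact (hy₂.2 s).1
            · exact hE.trans (by gcongr)
            · exact (hy₂.2 s).2
        _ = B * D / c * E * (M * w s) := by
            linear_combination (B * D * E * (M / c) * w s) * h1
    have hup := (abs_le.1 hdiff).2
    have hcoef : 2 * (B * D) / c * E ≤ c + L * rexp (c * s) * E + dampingCoeff k B c h₁ s := by
      linarith [hspec s, hle s]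
    have hprod := mul_le_mul_of_nonneg_right hcoef hMw
    have hBD : 2 * (B * D) / c * E * (M * w s) = 2 * (B * D / c * E * (M * w s)) := by ring
    show 0 ≤ M / 2 * ((c + L * rexp (c * s) * E) * w s) -
      (B * D - dampingCoeff k B c h₁ s * y₁ s - (B * D - dampingCoeff k B c h₂ s * y₂ s)) +
      dampingCoeff k B c h₁ s * (M / 2 * w s - (y₁ s - y₂ s))
    nlinarith
  · simpa using ((tendsto_contractionWeight_atBot hc D L).const_mul (M / 2)).sub
      ((hy₁.tendsto_atBot hc).sub (hy₂.tendsto_atBot hc))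

lemma abs_linear_solution_sub_le (hk : 0 < k) (hc : 0 < c) (hB : 0 < B) (hD : 0 < D)
    (hh₁ : ExpTrapped c D h₁) (hh₂ : ExpTrapped c D h₂)
    (hy₁ : ExpTrapped c D y₁) (hy₂ : ExpTrapped c D y₂)
    (hd₁ : ∀ s, HasDerivAt y₁ (B * D - dampingCoeff k B c h₁ s * y₁ s) s)
    (hd₂ : ∀ s, HasDerivAt y₂ (B * D - dampingCoeff k B c h₂ s * y₂ s) s)
    (hM : ∀ s, |h₁ s - h₂ s| ≤ M * contractionWeight c D (contractionRate c B D) s) (s : ℝ) :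
    |y₁ s - y₂ s| ≤ M / 2 * contractionWeight c D (contractionRate c B D) s := by
  have h := linear_solution_sub_le hk hc hB hD hh₁ hh₂ hy₁ hy₂ hd₁ hd₂ hM s
  have h' := linear_solution_sub_le hk hc hB hD hh₂ hh₁ hy₂ hy₁ hd₂ hd₁
    (fun s => by rw [abs_sub_comm]; exact hM s) s
  exact abs_le.2 ⟨by linarith, h⟩

lemma ExpTrapped.abs_sub_le_weight (hB : 0 < B) (hc : 0 < c) (hD : 0 < D)
    (hh₁ : ExpTrapped c D h₁) (hh₂ : ExpTrapped c D h₂) (s : ℝ) :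
    |h₁ s - h₂ s| ≤ D * contractionWeight c D (contractionRate c B D) s := by
  have h1 := hh₁.2 s
  have h2 := hh₂.2 s
  have hL : 0 < contractionRate c B D := by unfold contractionRate; positivity
  have h3 : D * rexp (c * s) ≤ D * contractionWeight c D (contractionRate c B D) s := by
    unfold contractionWeight
    gcongr
    exact le_add_of_nonneg_right (by positivity)
  exact abs_le.2 ⟨by linarith, by linarith⟩

end Contraction

/-- Uniqueness of trapped solutions of the nonlinear equation. -/
lemma ExpTrapped.eq_of_solution {k c B D : ℝ} {h₁ h₂ : ℝ → ℝ} (hk : 0 < k) (hc : 0 < c)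
    (hB : 0 < B) (hD : 0 < D) (hh₁ : ExpTrapped c D h₁) (hh₂ : ExpTrapped c D h₂)
    (hd₁ : ∀ s, HasDerivAt h₁ (B * D - dampingCoeff k B c h₁ s * h₁ s) s)
    (hd₂ : ∀ s, HasDerivAt h₂ (B * D - dampingCoeff k B c h₂ s * h₂ s) s) : h₁ = h₂ := by
  set w := contractionWeight c D (contractionRate c B D)
  have key : ∀ m : ℕ, ∀ s, |h₁ s - h₂ s| ≤ D * (1 / 2) ^ m * w s := by
    intro m
    induction m with
    | zero => simpa using hh₁.abs_sub_le_weight hB hc hD hh₂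
    | succ m ih =>
      intro s
      refine (abs_linear_solution_sub_le hk hc hB hD hh₁ hh₂ hh₁ hh₂ hd₁ hd₂ ih s).trans_eq ?_
      ring
  funext s
  have ht : Tendsto (fun m : ℕ => D * (1 / 2 : ℝ) ^ m * w s) atTop (nhds 0) := by
    simpa using ((tendsto_pow_atTop_nhds_zero_of_lt_one (by norm_num : (0 : ℝ) ≤ 1 / 2)
      (by norm_num)).const_mul D).mul_const (w s)
  have := ge_of_tendsto' ht fun m => key m s
  exact sub_eq_zero.1 (abs_nonpos_iff.1 this)

/-- Existence of a positive trapped solution of the nonlinear equation. -/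
lemma ExpTrapped.exists_solution {k c B D : ℝ} (hk : 0 < k) (hc : 0 < c)
    (hB : 0 < B) (hD : 0 < D) :
    ∃ h, ExpTrapped c D h ∧ (∀ s, 0 < h s) ∧
      ∀ s, HasDerivAt h (B * D - dampingCoeff k B c h s * h s) s := by
  have hex : ∀ h : {h // ExpTrapped c D h}, ∃ y : {h // ExpTrapped c D h}, (∀ s, 0 < y.1 s) ∧
      ∀ s, HasDerivAt y.1 (B * D - dampingCoeff k B c h.1 s * y.1 s) s := fun h => by
    obtain ⟨y, hy, hy'⟩ := h.2.exists_linear_solution hc hD hk hB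
    exact ⟨⟨y, hy⟩, hy'⟩
  choose T hTpos hT using hex
  have hzero : ExpTrapped c D fun _ => 0 :=
    ⟨continuous_const, fun s => ⟨le_rfl, by positivity⟩⟩
  set u : ℕ → {h // ExpTrapped c D h} := fun m => T^[m] ⟨_, hzero⟩
  have husucc : ∀ m, u (m + 1) = T (u m) := fun m => Function.iterate_succ_apply' T m _
  set w := contractionWeight c D (contractionRate c B D)
  have hw : ∀ s, 0 < w s := fun s => Real.exp_pos _
  have hwc : Continuous w := continuous_iff_continuousAt.2 fun s =>
    (hasDerivAt_contractionWeight hc hD _ s).continuousAt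
  have hstep : ∀ m s, |(u m).1 s - (u (m + 1)).1 s| ≤ D * (1 / 2) ^ m * w s := by
    intro m
    induction m with
    | zero => simpa using (u 0).2.abs_sub_le_weight hB hc hD (u 1).2
    | succ m ih =>
      intro s
      rw [husucc (m + 1), husucc m] at *
      refine (abs_linear_solution_sub_le hk hc hB hD (u m).2 (T (u m)).2 (T (u m)).2
        (T (T (u m))).2 (hT _) (hT _) ih s).trans_eq ?_
      ring
  have hdist : ∀ s m, dist ((u m).1 s) ((u (m + 1)).1 s) ≤ D * w s * (1 / 2) ^ m := fun s m => by
    rw [Real.dist_eq]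
    exact (hstep m s).trans_eq (by ring)
  choose h hlim using fun s => cauchySeq_tendsto_of_complete
    (cauchySeq_of_le_geometric (1 / 2) (D * w s) (by norm_num) (hdist s))
  have hclose : ∀ m s, |(u m).1 s - h s| ≤ 2 * D * (1 / 2) ^ m * w s := fun m s => by
    have := dist_le_of_le_geometric_of_tendsto (1 / 2) (D * w s) (by norm_num) (hdist s)
      (hlim s) m
    rw [Real.dist_eq] at this
    exact this.trans_eq (by ring)
  have hpow : ∀ C : ℝ, Tendsto (fun m : ℕ => C * (1 / 2 : ℝ) ^ m) atTop (nhds 0) := fun C => by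
    simpa using (tendsto_pow_atTop_nhds_zero_of_lt_one (by norm_num : (0 : ℝ) ≤ 1 / 2)
      (by norm_num)).const_mul C
  have hquot : Continuous fun s => h s / w s := by
    refine continuous_of_uniform_approx_of_continuous fun U hU => ?_
    obtain ⟨ε, hε, hεU⟩ := Metric.mem_uniformity_dist.1 hU
    obtain ⟨m, hm⟩ := ((hpow (2 * D)).eventually (gt_mem_nhds hε)).exists
    refine ⟨fun s => (u m).1 s / w s, (u m).2.1.div hwc fun s => (hw s).ne', fun s => hεU ?_⟩
    rw [dist_comm, Real.dist_eq, ← sub_div, abs_div, abs_of_pos (hw s), div_lt_iff₀ (hw s)]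
    exact (hclose m s).trans_lt (mul_lt_mul_of_pos_right hm (hw s))
  have hcont : Continuous h := by
    refine (hquot.mul hwc).congr fun s => ?_
    exact div_mul_cancel₀ _ (hw s).ne'
  have hh : ExpTrapped c D h := ⟨hcont, fun s =>
    ⟨ge_of_tendsto' (hlim s) fun m => ((u m).2.2 s).1,
      le_of_tendsto' (hlim s) fun m => ((u m).2.2 s).2⟩⟩
  have hfix : (T ⟨h, hh⟩).1 = h := by
    funext s
    have hconv : Tendsto (fun m => (u (m + 1)).1 s) atTop (nhds ((T ⟨h, hh⟩).1 s)) := by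
      rw [tendsto_iff_dist_tendsto_zero]
      refine squeeze_zero (fun m => dist_nonneg) (fun m => ?_) (hpow (D * w s))
      rw [Real.dist_eq, husucc]
      exact (abs_linear_solution_sub_le hk hc hB hD (u m).2 hh (T (u m)).2 (T ⟨h, hh⟩).2
        (hT _) (hT _) (hclose m) s).trans_eq (by ring)
    exact tendsto_nhds_unique hconv ((tendsto_add_atTop_iff_nat 1).2 (hlim s))
  refine ⟨h, hh, fun s => ?_, fun s => ?_⟩
  · have := hTpos ⟨h, hh⟩ s
    rwa [hfix] at this
  · have := hT ⟨h, hh⟩ s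
    rwa [hfix] at this

/-- The boundary value problem is the trapped nonlinear equation with `k = n - 2`,
`c = ρ1 / β0`, `B = β0 η` and `D = C0 / η`. -/
lemma hODEReal_iff {n : ℕ} {η ρ1 β0 α0 C0 : ℝ} (hη : 0 < η) (hρ1 : 0 < ρ1) (hβ0 : 0 < β0)
    (hC0 : C0 = α0 * ((n : ℝ) - 2) / β0 ^ 2) (h : ℝ → ℝ) :
    HODEReal n ρ1 η β0 α0 C0 h ↔ ExpTrapped (ρ1 / β0) (C0 / η) h ∧ (∀ s, 0 < h s) ∧
      ∀ s, HasDerivAt h (β0 * η * (C0 / η) -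
        dampingCoeff ((n : ℝ) - 2) (β0 * η) (ρ1 / β0) h s * h s) s := by
  have hA : β0 * η * (C0 / η) = α0 * ((n : ℝ) - 2) / β0 := by
    rw [hC0]
    field_simp
  have hc : 0 < ρ1 / β0 := by positivity
  have hbound : ∀ s, h s * rexp (-(ρ1 / β0) * s) ≤ C0 / η ↔
      h s ≤ C0 / η * rexp (ρ1 / β0 * s) := fun s => by
    rw [neg_mul, Real.exp_neg, ← div_eq_mul_inv, div_le_iff₀ (Real.exp_pos _)]
  have hpos : ∀ s, 0 < h s * rexp (-(ρ1 / β0) * s) ↔ 0 < h s := fun s =>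
    mul_pos_iff_of_pos_right (Real.exp_pos _)
  rw [hA]
  constructor
  · rintro ⟨hdiff, -, hode, htrap⟩
    have hp : ∀ s, 0 < h s := fun s => (hpos s).1 (htrap s).1
    refine ⟨⟨hdiff.continuous, fun s => ⟨(hp s).le, (hbound s).1 (htrap s).2⟩⟩, hp, fun s => ?_⟩
    convert! (hdiff.differentiable one_ne_zero s).hasDerivAt using 1
    rw [← hode s, dampingCoeff]
    ring
  · rintro ⟨hh, hp, hd⟩
    refine ⟨contDiff_one_iff_deriv.2 ⟨fun s => (hd s).differentiableAt, ?_⟩,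
      fun s => (hh.integrableOn_Iic hc s).mono_set Iio_subset_Iic_self, fun s => ?_,
      fun s => ⟨(hpos s).2 (hp s), (hbound s).2 (hh.2 s).2⟩⟩
    · rw [funext fun s => (hd s).deriv]
      exact continuous_const.sub ((hh.continuous_dampingCoeff hc _ _).mul hh.1)
    · rw [(hd s).deriv, dampingCoeff]
      ring

theorem stmt12 (n : ℕ) (η ρ1 β0 α0 C0 : ℝ)
    (hn : 3 ≤ n) (hη : 0 < η) (hρ1 : 0 < ρ1) (hβ0 : 0 < β0)
    (hα0 : α0 = 2 * β0 + ρ1)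
    (hC0 : C0 = α0 * ((n : ℝ) - 2) / β0 ^ 2) :
    ∃! h : ℝ → ℝ, HODEReal n ρ1 η β0 α0 C0 h := by
  have hn' : (3 : ℝ) ≤ n := by exact_mod_cast hn
  have hk : 0 < (n : ℝ) - 2 := by linarith
  have hc : 0 < ρ1 / β0 := by positivity
  have hB : 0 < β0 * η := by positivity
  have hD : 0 < C0 / η := by
    have : 0 < α0 := by rw [hα0]; positivity
    rw [hC0]
    positivity
  simp only [hODEReal_iff hη hρ1 hβ0 hC0]
  obtain ⟨h, hh⟩ := ExpTrapped.exists_solution hk hc hB hD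
  exact ⟨h, hh, fun y hy => hy.1.eq_of_solution hk hc hB hD hh.1 hy.2.2 hh.2.2⟩
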